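/- arXiv:2301.06481 — 4 statements merged into one kernel-verified Lean document; each statement's English description precedes it below -/
import Mathlib

section
/- Let R be a commutative ring and let u, ξ, ζ, w, η, F₁, F₂, F₃, G₁, G₂, G₃ ∈ R. Set f = F₁u + F₂ξ + F₃ζ and g = G₁u + G₂ξ + G₃ζ. Let M be the 5 × 5 antisymmetric matrix with upper-triangular entries M₁₂ = u, M₁₃ = −ξ, M₁₄ = G₃, M₁₅ = F₃, M₂₃ = ζ, M₂₄ = G₂, M₂₅ = F₂, M₃₄ = G₁, M₃₅ = F₁, M₄₅ = η, and for 1 ≤ i ≤ 5 let Pf_i denote the Pfaffian of the 4 × 4 antisymmetric submatrix of M obtained by deleting the i-th row and column. Then Pf₅ = g, Pf₄ = f, Pf₃ = ηu − (F₂G₃ − F₃G₂), Pf₂ = −(ηξ − (F₃G₁ − F₁G₃)), Pf₁ = ηζ − (F₁G₂ − F₂G₁). In particular, the ideal generated by the five maximal Pfaffians of M equals the ideal (f, g, ηu − (F₂G₃ − F₃G₂), ηξ − (F₃G₁ − F₁G₃), ηζ − (F₁G₂ − F₂G₁)). -/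
/-- The Pfaffian of a `4 × 4` antisymmetric matrix: `A₁₂A₃₄ − A₁₃A₂₄ + A₁₄A₂₃`. -/
def pfaffian4 {R : Type*} [CommRing R] (A : Matrix (Fin 4) (Fin 4) R) : R :=
  A 0 1 * A 2 3 - A 0 2 * A 1 3 + A 0 3 * A 1 2

/-- The five maximal Pfaffians of the `5 × 5` antisymmetric matrix `M` of the
Kustin–Miller unprojection recover `f`, `g` and the three unprojection equations,
and the ideal they generate equals `(f, g, ηu − (F₂G₃ − F₃G₂), ηξ − (F₃G₁ − F₁G₃),
ηζ − (F₁G₂ − F₂G₁))`. -/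
theorem stmt1 {R : Type*} [CommRing R]
    (u ξ ζ w η F₁ F₂ F₃ G₁ G₂ G₃ f g : R)
    (hf : f = F₁ * u + F₂ * ξ + F₃ * ζ)
    (hg : g = G₁ * u + G₂ * ξ + G₃ * ζ)
    (M : Matrix (Fin 5) (Fin 5) R)
    (hM : M = !![0, u, -ξ, G₃, F₃;
                 -u, 0, ζ, G₂, F₂;
                 ξ, -ζ, 0, G₁, F₁;
                 -G₃, -G₂, -G₁, 0, η;
                 -F₃, -F₂, -F₁, -η, 0])
    (Pf : Fin 5 → R)
    (hPf : ∀ i : Fin 5, Pf i = pfaffian4 (M.submatrix i.succAbove i.succAbove)) :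
    Pf 4 = g ∧
    Pf 3 = f ∧
    Pf 2 = η * u - (F₂ * G₃ - F₃ * G₂) ∧
    Pf 1 = -(η * ξ - (F₃ * G₁ - F₁ * G₃)) ∧
    Pf 0 = η * ζ - (F₁ * G₂ - F₂ * G₁) ∧
    Ideal.span {Pf 0, Pf 1, Pf 2, Pf 3, Pf 4} =
      Ideal.span {f, g, η * u - (F₂ * G₃ - F₃ * G₂),
        η * ξ - (F₃ * G₁ - F₁ * G₃), η * ζ - (F₁ * G₂ - F₂ * G₁)} := by
  have h4 : Pf 4 = g := by
    rw [hPf, hM, hg]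
    simp [pfaffian4, Fin.succAbove, Fin.lt_def]
    ring
  have h3 : Pf 3 = f := by
    rw [hPf, hM, hf]
    simp [pfaffian4, Fin.succAbove, Fin.lt_def]
    ring
  have h2 : Pf 2 = η * u - (F₂ * G₃ - F₃ * G₂) := by
    rw [hPf, hM]
    simp [pfaffian4, Fin.succAbove, Fin.lt_def]
    ring
  have h1 : Pf 1 = -(η * ξ - (F₃ * G₁ - F₁ * G₃)) := by
    rw [hPf, hM]
    simp [pfaffian4, Fin.succAbove, Fin.lt_def]
    ring
  have h0 : Pf 0 = η * ζ - (F₁ * G₂ - F₂ * G₁) := by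
    rw [hPf, hM]
    simp [pfaffian4]
    ring
  refine ⟨h4, h3, h2, h1, h0, ?_⟩
  rw [h0, h1, h2, h3, h4]
  simp only [Ideal.span_insert, Ideal.span_singleton_neg]
  generalize Ideal.span {η * u - (F₂ * G₃ - F₃ * G₂)} = a
  generalize Ideal.span {η * ξ - (F₃ * G₁ - F₁ * G₃)} = b
  generalize Ideal.span {η * ζ - (F₁ * G₂ - F₂ * G₁)} = c
  ac_rfl
end

section
/- Let R be a commutative ring and let η, F₁, F₃, G₁, G₃, H₁, H₂, H₃, H₄ ∈ R. Let B be the 3 × 4 matrix over R with rows (−H₁F₁, −H₂F₁, η − H₃F₁, G₁ − H₄F₁), (0, −η, G₁, −F₁), (η + H₁F₃, H₂F₃, H₃F₃, −G₃ + H₄F₃), and for 1 ≤ j ≤ 4 let h_j = (−1)^{j+1} det(B_j), where B_j is the 3 × 3 matrix obtained from B by deleting column j. Then for each j there exist elements K_j, L_j ∈ R such that h_j = η·K_j + (F₁G₃ − G₁F₃)·L_j. -/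
/-- Each signed maximal minor `h_j` of the `3 × 4` syzygy matrix `B` factors as
`η·K_j + (F₁G₃ − G₁F₃)·L_j`. -/
theorem stmt3 {R : Type*} [CommRing R]
    (η F₁ F₃ G₁ G₃ H₁ H₂ H₃ H₄ : R)
    (B : Matrix (Fin 3) (Fin 4) R)
    (hB : B = !![-H₁ * F₁, -H₂ * F₁, η - H₃ * F₁, G₁ - H₄ * F₁;
                 0, -η, G₁, -F₁;
                 η + H₁ * F₃, H₂ * F₃, H₃ * F₃, -G₃ + H₄ * F₃])
    (h : Fin 4 → R)
    (hh : ∀ j : Fin 4,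
      h j = (-1 : R) ^ (j : ℕ) * (B.submatrix id j.succAbove).det) :
    ∀ j : Fin 4, ∃ K L : R, h j = η * K + (F₁ * G₃ - G₁ * F₃) * L := by
  subst hB
  intro j
  rw [hh j, Matrix.det_fin_three]
  fin_cases j
  · refine ⟨(η - H₃ * F₁) * (-G₃ + H₄ * F₃) - H₂ * F₁ * F₃ - H₃ * F₃ * (G₁ - H₄ * F₁),
      H₂ * G₁, ?_⟩
    simp
    ring
  · refine ⟨H₁ * F₁ * F₃ + (η - H₃ * F₁) * F₁ + G₁ * (G₁ - H₄ * F₁), -(H₁ * G₁), ?_⟩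
    simp [Fin.succAbove, Fin.lt_def]
    ring
  · refine ⟨H₁ * F₁ * (-G₃ + H₄ * F₃) + H₂ * F₁ ^ 2 + (η + H₁ * F₃) * (G₁ - H₄ * F₁), 0, ?_⟩
    simp [Fin.succAbove, Fin.lt_def]
    ring
  · refine ⟨-(H₁ * H₃ * F₁ * F₃ - H₂ * F₁ * G₁ + (η + H₁ * F₃) * (η - H₃ * F₁)), 0, ?_⟩
    simp [Fin.succAbove, Fin.lt_def]
    ring
end

section
/- Let ψ : ℂ[x₁, …, x₁₂] → ℂ[u, v, x, y, w, t] be the ℂ-algebra homomorphism between polynomial rings determined by ψ(x₁) = t², ψ(x₂) = tw, ψ(x₃) = tv, ψ(x₄) = tu, ψ(x₅) = w², ψ(x₆) = wv, ψ(x₇) = wu, ψ(x₈) = v², ψ(x₉) = vu, ψ(x₁₀) = u², ψ(x₁₁) = y, ψ(x₁₂) = x. Then the kernel of ψ equals the ideal of ℂ[x₁, …, x₁₂] generated by the 2 × 2 minors of the symmetric 4 × 4 matrix A = [[x₁, x₂, x₃, x₄], [x₂, x₅, x₆, x₇], [x₃, x₆, x₈, x₉], [x₄, x₇, x₉, x₁₀]]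 (the condition rank A ≤ 1). -/
open MvPolynomial

namespace SymmetricMinors

/-- The exponent vectors, in the variables `u, v, x, y, w, t`, of the twelve invariants. -/
def weight : Fin 12 → Fin 6 → ℕ :=
  ![![0, 0, 0, 0, 0, 2], ![0, 0, 0, 0, 1, 1], ![0, 1, 0, 0, 0, 1], ![1, 0, 0, 0, 0, 1],
    ![0, 0, 0, 0, 2, 0], ![0, 1, 0, 0, 1, 0], ![1, 0, 0, 0, 1, 0],
    ![0, 2, 0, 0, 0, 0], ![1, 1, 0, 0, 0, 0], ![2, 0, 0, 0, 0, 0],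
    ![0, 0, 0, 1, 0, 0], ![0, 0, 1, 0, 0, 0]]

/-- The index of the variable in position `(i, j)` of the symmetric matrix. -/
def entry : Fin 4 → Fin 4 → Fin 12 :=
  ![![0, 1, 2, 3], ![1, 4, 5, 6], ![2, 5, 7, 8], ![3, 6, 8, 9]]

/-- The positions of `t, w, v, u` among the variables `u, v, x, y, w, t`. -/
def letter : Fin 4 → Fin 6 := ![5, 4, 1, 0]

lemma entry_comm (i j : Fin 4) : entry i j = entry j i := by
  revert i j; decide

lemma eq_entry_or (v : Fin 12) : (∃ i j, v = entry i j) ∨ v = 10 ∨ v = 11 := by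
  revert v; decide

lemma exists_weight_pos (v : Fin 12) : ∃ r, 0 < weight v r := by
  revert v; decide

lemma eq_of_weight_three_pos {v : Fin 12} : 0 < weight v 3 → v = 10 := by
  revert v; decide

lemma eq_of_weight_two_pos {v : Fin 12} : 0 < weight v 2 → v = 11 := by
  revert v; decide

lemma exists_entry_of_weight_pos {v : Fin 12} {i : Fin 4} :
    0 < weight v (letter i) → ∃ k, v = entry i k := by
  revert v i; decide

lemma weight_entry_pos (i j : Fin 4) : 0 < weight (entry i j) (letter i) := by
  revert i j; decide

lemma weight_entry_lt {i j k : Fin 4} :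
    k ≠ j → weight (entry i k) (letter j) < weight (entry i j) (letter j) := by
  revert i j k; decide

lemma weight_entry_add (i j k l : Fin 4) (r : Fin 6) :
    weight (entry i k) r + weight (entry j l) r =
      weight (entry i j) r + weight (entry k l) r := by
  revert i j k l r; decide

/-- The exponent of the image of the monomial with exponent `d`. -/
def imageExponent (d : Fin 12 →₀ ℕ) (r : Fin 6) : ℕ := ∑ v, d v * weight v r

lemma imageExponent_single_add (v : Fin 12) (d : Fin 12 →₀ ℕ) (r : Fin 6) :
    imageExponent (Finsupp.single v 1 + d) r = weight v r + imageExponent d r := by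
  simp [imageExponent, add_mul, Finset.sum_add_distrib, Finsupp.single_apply]

lemma exists_eq_single_add {d : Fin 12 →₀ ℕ} {v : Fin 12} (h : d v ≠ 0) :
    ∃ d', d = Finsupp.single v 1 + d' :=
  le_iff_exists_add.mp (Finsupp.single_le_iff.mpr (Nat.one_le_iff_ne_zero.mpr h))

lemma exists_of_imageExponent_pos {d : Fin 12 →₀ ℕ} {r : Fin 6} (h : 0 < imageExponent d r) :
    ∃ v d', 0 < weight v r ∧ d = Finsupp.single v 1 + d' := by
  obtain ⟨v, -, hv⟩ := Finset.exists_ne_zero_of_sum_ne_zero h.ne'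
  obtain ⟨d', hd'⟩ := exists_eq_single_add (left_ne_zero_of_mul hv)
  exact ⟨v, d', Nat.pos_of_ne_zero (right_ne_zero_of_mul hv), hd'⟩

lemma eq_zero_of_imageExponent {d : Fin 12 →₀ ℕ} (h : ∀ r, imageExponent d r = 0) : d = 0 := by
  ext v
  by_contra hv
  obtain ⟨r, hr⟩ := exists_weight_pos v
  obtain ⟨d', rfl⟩ := exists_eq_single_add hv
  have := h r
  rw [imageExponent_single_add] at this
  omega

/-- A multiplicative function on exponents satisfying the minor relations only depends on the
exponent of the image monomial. -/
lemma eq_of_imageExponent_eq {Q : Type*} [CommRing Q] (x : Fin 12 → Q) (g : (Fin 12 →₀ ℕ) → Q)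
    (hg : ∀ v d, g (Finsupp.single v 1 + d) = x v * g d)
    (hx : ∀ i j k l, x (entry i k) * x (entry j l) = x (entry i j) * x (entry k l))
    (n : ℕ) (d d' : Fin 12 →₀ ℕ) (hn : d.degree = n)
    (h : ∀ r, imageExponent d r = imageExponent d' r) :
    g d = g d' := by
  induction n generalizing d d' with
  | zero =>
    obtain rfl : d = 0 := (Finsupp.degree_eq_zero_iff d).mp hn
    rw [eq_zero_of_imageExponent (d := d') fun r => by rw [← h r]; simp [imageExponent]]
  | succ n ih =>
    obtain ⟨v, hv⟩ : ∃ v, d v ≠ 0 := by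
      by_contra! h0
      obtain rfl : d = 0 := Finsupp.ext h0
      simp at hn
    obtain ⟨d, rfl⟩ := exists_eq_single_add hv
    replace hn : d.degree = n := by
      rw [map_add, Finsupp.degree_single] at hn; omega
    have key : ∀ d₁, d' = Finsupp.single v 1 + d₁ → g (Finsupp.single v 1 + d) = g d' := by
      rintro d₁ rfl
      rw [hg, hg, ih d d₁ hn fun r => by simpa [imageExponent_single_add] using h r]
    have hpos : ∀ r, 0 < weight v r → 0 < imageExponent d' r := fun r hr => by
      rw [← h r, imageExponent_single_add]; omega
    rcases eq_entry_or v with ⟨i, j, rfl⟩ | rfl | rfl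
    · obtain ⟨v, d₁, hv, rfl⟩ := exists_of_imageExponent_pos (hpos _ (weight_entry_pos i j))
      obtain ⟨k, rfl⟩ := exists_entry_of_weight_pos hv
      by_cases hkj : k = j
      · subst hkj
        exact key d₁ rfl
      · have hj := h (letter j)
        have hlt := weight_entry_lt (i := i) hkj
        rw [imageExponent_single_add, imageExponent_single_add] at hj
        obtain ⟨v, d₂, hv, rfl⟩ := exists_of_imageExponent_pos (d := d₁) (r := letter j) (by omega)
        obtain ⟨l, rfl⟩ := exists_entry_of_weight_pos hv
        rw [hg, hg, hg, ← mul_assoc, hx, mul_assoc, ← hg (entry k l), ih d _ hn fun r => ?_]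
        have := h r
        have := weight_entry_add i j k l r
        simp only [imageExponent_single_add] at *
        omega
    · obtain ⟨v, d₁, hv, hd⟩ := exists_of_imageExponent_pos (hpos 3 (by decide))
      exact key d₁ (eq_of_weight_three_pos hv ▸ hd)
    · obtain ⟨v, d₁, hv, hd⟩ := exists_of_imageExponent_pos (hpos 2 (by decide))
      exact key d₁ (eq_of_weight_two_pos hv ▸ hd)

end SymmetricMinors

open SymmetricMinors in
/-- The kernel of the ℂ-algebra map `ψ : ℂ[x₁, …, x₁₂] → ℂ[u, v, x, y, w, t]`
(variables of the target indexed `u = 0, v = 1, x = 2, y = 3, w = 4, t = 5`;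
variables of the source `x₁, …, x₁₂` indexed `0, …, 11`) sending
`x₁, …, x₁₂` to `t², tw, tv, tu, w², wv, wu, v², vu, u², y, x`
is the ideal generated by the `2 × 2` minors of the symmetric matrix `A`. -/
theorem stmt10 (ψ : MvPolynomial (Fin 12) ℂ →ₐ[ℂ] MvPolynomial (Fin 6) ℂ)
    (hψ : ψ = MvPolynomial.aeval
      ![X 5 ^ 2, X 5 * X 4, X 5 * X 1, X 5 * X 0,
        X 4 ^ 2, X 4 * X 1, X 4 * X 0,
        X 1 ^ 2, X 1 * X 0, X 0 ^ 2, X 3, X 2])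
    (A : Matrix (Fin 4) (Fin 4) (MvPolynomial (Fin 12) ℂ))
    (hA : A = !![X 0, X 1, X 2, X 3;
                 X 1, X 4, X 5, X 6;
                 X 2, X 5, X 7, X 8;
                 X 3, X 6, X 8, X 9]) :
    RingHom.ker ψ =
      Ideal.span {m : MvPolynomial (Fin 12) ℂ |
        ∃ i j k l : Fin 4, m = A i k * A j l - A i l * A j k} := by
  have hA' : ∀ i j, A i j = X (entry i j) := by
    intro i j
    subst hA
    fin_cases i <;> fin_cases j <;> rfl
  have hψX : ∀ v, ψ (X v) = ∏ r, X r ^ weight v r := by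
    intro v
    rw [hψ, aeval_X]
    fin_cases v <;> simp [Fin.prod_univ_succ, weight] <;> first | rfl | exact mul_comm _ _
  have hψA : ∀ i j, ψ (A i j) = X (letter i) * X (letter j) := by
    intro i j
    rw [hA', hψ, aeval_X]
    fin_cases i <;> fin_cases j <;> simp [entry, letter, pow_two, mul_comm]
  apply le_antisymm
  · set I := Ideal.span {m : MvPolynomial (Fin 12) ℂ |
        ∃ i j k l : Fin 4, m = A i k * A j l - A i l * A j k}
    let e : (Fin 12 →₀ ℕ) → (Fin 6 →₀ ℕ) := fun d => Finsupp.equivFunOnFinite.symm (imageExponent d)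
    have he : ∀ d, ψ (monomial d 1) = monomial (e d) 1 := by
      intro d
      rw [monomial_eq, monomial_eq, Finsupp.prod_fintype _ _ (by simp),
        Finsupp.prod_fintype _ _ (by simp)]
      simp only [map_one, one_mul, map_prod, map_pow, hψX, ← Finset.prod_pow, ← pow_mul]
      rw [Finset.prod_comm]
      simp only [e, Finsupp.equivFunOnFinite_symm_apply_apply, imageExponent,
        Finset.prod_pow_eq_pow_sum, mul_comm (weight _ _)]
    let q := Ideal.Quotient.mkₐ ℂ I
    let g : (Fin 12 →₀ ℕ) → MvPolynomial (Fin 12) ℂ ⧸ I := fun d => q (monomial d 1)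
    have hfac : g.FactorsThrough e := by
      intro d d' hd
      refine eq_of_imageExponent_eq (fun v => q (X v)) g ?_ ?_ _ d d' rfl
        fun r => DFunLike.congr_fun hd r
      · intro v d
        simp only [g, ← map_mul, X, monomial_mul, one_mul]
      · intro i j k l
        rw [← map_mul, ← map_mul]
        refine Ideal.Quotient.eq.mpr (Ideal.subset_span ⟨i, l, k, j, ?_⟩)
        simp only [hA', entry_comm l]
    have hlin : q.toLinearMap =
        ((basisMonomials (Fin 6) ℂ).constr ℂ (Function.extend e g 0)) ∘ₗ ψ.toLinearMap := by
      refine (basisMonomials (Fin 12) ℂ).ext fun d => ?_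
      have := (basisMonomials (Fin 6) ℂ).constr_basis ℂ (Function.extend e g 0) (e d)
      rw [coe_basisMonomials, hfac.extend_apply] at this
      simp only [coe_basisMonomials, LinearMap.comp_apply, AlgHom.toLinearMap_apply, he]
      exact this.symm
    intro f hf
    have hf0 := LinearMap.congr_fun hlin f
    rw [LinearMap.comp_apply, AlgHom.toLinearMap_apply, AlgHom.toLinearMap_apply,
      (RingHom.mem_ker).mp hf, map_zero] at hf0
    exact Ideal.Quotient.eq_zero_iff_mem.mp hf0
  · rw [Ideal.span_le]
    rintro _ ⟨i, j, k, l, rfl⟩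
    rw [SetLike.mem_coe, RingHom.mem_ker, map_sub, map_mul, map_mul, hψA, hψA, hψA, hψA]
    ring
end

section
/- Let R = ℂ[x, y, z, ξ, v, w] be the polynomial ring in six variables with the weighted grading in which x, y, z, ξ, v, w have weights 2, 3, 4, 5, 7, 9 respectively. Let f₇ ∈ ℂ[x, y, z] be weighted homogeneous of degree 7, and let g₉, f₁₂, g₁₄ ∈ ℂ[x, y, z, v] be weighted homogeneous of degrees 9, 12, 14 respectively. Set f = ξ²x + ξ(v + f₇) + wy + z³ + f₁₂ and g = ξ²(z + x²) + ξ(w + g₉) + v² + y⁴x + g₁₄. Then there exist weighted homogeneous polynomials h₇ ∈ ℂ[x, y, z] of degree 7, h₉ ∈ ℂ[x, y, z, v] of degree 9, F₁₂ ∈ ℂ[x, y, z, v] of degree 12, G₁₄ ∈ ℂ[x, y, z, v] of degree 14, and a ℂ-algebra automorphism φ of R preserving the weighted grading, such that the image under φ of the ideal (f, g) equals the ideal (ξ(v + h₇) + y(w − h₉) + z³ + F₁₂, ξw + v² + y⁴x + G₁₄). -/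
open MvPolynomial

namespace MvPolynomial

variable {σ R : Type*} [CommRing R]

lemma IsWeightedHomogeneous.aeval {τ : Type*} {w : σ → ℕ} {w' : τ → ℕ} {p : MvPolynomial σ R}
    {d : ℕ} (hp : p.IsWeightedHomogeneous w d) {q : σ → MvPolynomial τ R}
    (hq : ∀ j, (q j).IsWeightedHomogeneous w' (w j)) :
    (MvPolynomial.aeval q p).IsWeightedHomogeneous w' d := by
  induction hp using IsWeightedHomogeneous.induction_on with
  | zero => simpa using isWeightedHomogeneous_zero R w' d
  | add p q _ _ hp hq => simpa using hp.add hq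
  | monomial e r he =>
    rw [aeval_monomial, ← he, Finsupp.weight_apply]
    exact (IsWeightedHomogeneous.prod e.support _ _ fun j _ => (hq j).pow (e j)).C_mul r

/-- Variables of weight exceeding the degree do not occur. -/
lemma IsWeightedHomogeneous.mem_supported_diff {w : σ → ℕ} {p : MvPolynomial σ R} {d : ℕ}
    (hp : p.IsWeightedHomogeneous w d) {s : Set σ} (hs : p ∈ supported R s) {i : σ}
    (hi : d < w i) : p ∈ supported R (s \ {i}) := by
  rw [mem_supported] at hs ⊢
  refine fun j hj => ⟨hs hj, ?_⟩
  rintro rfl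
  obtain ⟨e, he, hje⟩ := mem_vars_iff_mem_support j |>.1 hj
  have h₁ := hp (mem_support_iff.1 he)
  have h₂ := Finsupp.le_weight_of_ne_zero' w (Finsupp.mem_support_iff.1 hje)
  omega

/-- Division of a weighted homogeneous polynomial by a variable. -/
lemma IsWeightedHomogeneous.exists_eq_add_X_mul {w : σ → ℕ} {p : MvPolynomial σ R} {d e : ℕ}
    {s : Set σ} {i : σ} (hp : p.IsWeightedHomogeneous w d) (hs : p ∈ supported R s)
    (hde : d = w i + e) :
    ∃ a b : MvPolynomial σ R, p = a + X i * b ∧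
      a ∈ supported R (s \ {i}) ∧ a.IsWeightedHomogeneous w d ∧
      b ∈ supported R s ∧ b.IsWeightedHomogeneous w e := by
  classical
  rw [mem_supported] at hs
  have hmod {c : σ →₀ ℕ} (hc : coeff c (modMonomial p (Finsupp.single i 1)) ≠ 0) :
      ¬ Finsupp.single i 1 ≤ c ∧ coeff c p ≠ 0 := by
    have h : ¬ Finsupp.single i 1 ≤ c := fun h => hc (coeff_modMonomial_of_le p h)
    exact ⟨h, by rwa [coeff_modMonomial_of_not_le p h] at hc⟩
  refine ⟨modMonomial p (Finsupp.single i 1), divMonomial p (Finsupp.single i 1),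
    (modMonomial_add_divMonomial_single p i).symm, ?_, ?_, ?_, ?_⟩
  · rw [mem_supported]
    intro j hj
    obtain ⟨c, hc, hjc⟩ := mem_vars_iff_mem_support j |>.1 hj
    obtain ⟨hle, hc'⟩ := hmod (mem_support_iff.1 hc)
    refine ⟨hs ((mem_vars_iff_mem_support j).2 ⟨c, mem_support_iff.2 hc', hjc⟩), ?_⟩
    rintro rfl
    exact hle (Finsupp.single_le_iff.2
      (Nat.one_le_iff_ne_zero.2 (Finsupp.mem_support_iff.1 hjc)))
  · exact fun c hc => hp (hmod hc).2
  · rw [mem_supported]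
    intro j hj
    obtain ⟨c, hc, hjc⟩ := mem_vars_iff_mem_support j |>.1 hj
    rw [mem_support_iff, coeff_divMonomial] at hc
    refine hs ((mem_vars_iff_mem_support j).2 ⟨_, mem_support_iff.2 hc, ?_⟩)
    rw [Finsupp.mem_support_iff] at hjc ⊢
    rw [Finsupp.add_apply]
    omega
  · intro c hc
    rw [coeff_divMonomial] at hc
    have h := hp hc
    rw [map_add, Finsupp.weight_single, one_smul] at h
    omega

/-- Two algebra homomorphisms agreeing on the variables in `s` agree on `supported R s`. -/
lemma algHom_eq_of_mem_supported {A : Type*} [CommRing A] [Algebra R A]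
    {φ ψ : MvPolynomial σ R →ₐ[R] A} {s : Set σ} (h : ∀ j ∈ s, φ (X j) = ψ (X j))
    {q : MvPolynomial σ R} (hq : q ∈ supported R s) : φ q = ψ q := by
  refine AlgHom.adjoin_le_equalizer φ ψ ?_ hq
  rintro _ ⟨j, hj, rfl⟩
  exact h j hj

/-- The elementary automorphism `X i ↦ X i - p`, for `p` not involving `X i`. -/
lemma exists_elementary_algEquiv {w : σ → ℕ} (i : σ) {p : MvPolynomial σ R}
    (hp : p ∈ supported R {i}ᶜ) (hw : p.IsWeightedHomogeneous w (w i)) :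
    ∃ φ : MvPolynomial σ R ≃ₐ[R] MvPolynomial σ R,
      φ (X i) = X i - p ∧ (∀ q ∈ supported R {i}ᶜ, φ q = q) ∧
      ∀ (d : ℕ) (q : MvPolynomial σ R),
        q.IsWeightedHomogeneous w d → (φ q).IsWeightedHomogeneous w d := by
  classical
  let shift (r : MvPolynomial σ R) : MvPolynomial σ R →ₐ[R] MvPolynomial σ R :=
    MvPolynomial.aeval (Function.update X i (X i + r))
  have shift_self (r) : shift r (X i) = X i + r := by simp [shift]
  have shift_fix (r) : ∀ q ∈ supported R {i}ᶜ, shift r q = q := fun q hq =>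
    algHom_eq_of_mem_supported (ψ := AlgHom.id R _)
      (fun j hj => by simp [shift, Function.update_of_ne (show j ≠ i from hj)]) hq
  have shift_comp (r) (hr : r ∈ supported R {i}ᶜ) :
      (shift r).comp (shift (-r)) = AlgHom.id R _ := by
    nontriviality R
    refine algHom_ext fun j => ?_
    by_cases hj : j = i
    · subst hj
      simp [shift_self, shift_fix r r hr]
    · have hX : X j ∈ supported R {i}ᶜ := X_mem_supported.2 hj
      simp [shift_fix _ _ hX]
  refine ⟨AlgEquiv.ofAlgHom (shift (-p)) (shift p)
    (by simpa using shift_comp (-p) (neg_mem hp)) (shift_comp p hp),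
    by simp [shift_self, sub_eq_add_neg], fun q hq => shift_fix _ q hq, fun d q hq => ?_⟩
  refine hq.aeval fun j => ?_
  by_cases hj : j = i
  · subst hj
    simpa using (isWeightedHomogeneous_X R w j).add hw.neg
  · simpa [Function.update_of_ne hj] using isWeightedHomogeneous_X R w j

end MvPolynomial

/-- Normal form for a general member of family 123: in `ℂ[x, y, z, ξ, v, w]`
(variables indexed `x = 0, y = 1, z = 2, ξ = 3, v = 4, w = 5`, with weights
`2, 3, 4, 5, 7, 9`), for `f = ξ²x + ξ(v + f₇) + wy + z³ + f₁₂` and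
`g = ξ²(z + x²) + ξ(w + g₉) + v² + y⁴x + g₁₄` there exist weighted homogeneous
`h₇ ∈ ℂ[x,y,z]`, `h₉, F₁₂, G₁₄ ∈ ℂ[x,y,z,v]` of degrees `7, 9, 12, 14` and a
grading-preserving ℂ-algebra automorphism `φ` such that the image of `(f, g)`
under `φ` equals `(ξ(v + h₇) + y(w − h₉) + z³ + F₁₂, ξw + v² + y⁴x + G₁₄)`. -/
theorem stmt12
    (wt : Fin 6 → ℕ) (hwt : wt = ![2, 3, 4, 5, 7, 9])
    (f₇ g₉ f₁₂ g₁₄ : MvPolynomial (Fin 6) ℂ)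
    (hf₇s : f₇ ∈ MvPolynomial.supported ℂ ({0, 1, 2} : Set (Fin 6)))
    (hf₇h : f₇.IsWeightedHomogeneous wt 7)
    (hg₉s : g₉ ∈ MvPolynomial.supported ℂ ({0, 1, 2, 4} : Set (Fin 6)))
    (hg₉h : g₉.IsWeightedHomogeneous wt 9)
    (hf₁₂s : f₁₂ ∈ MvPolynomial.supported ℂ ({0, 1, 2, 4} : Set (Fin 6)))
    (hf₁₂h : f₁₂.IsWeightedHomogeneous wt 12)
    (hg₁₄s : g₁₄ ∈ MvPolynomial.supported ℂ ({0, 1, 2, 4} : Set (Fin 6)))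
    (hg₁₄h : g₁₄.IsWeightedHomogeneous wt 14)
    (f g : MvPolynomial (Fin 6) ℂ)
    (hf : f = X 3 ^ 2 * X 0 + X 3 * (X 4 + f₇) + X 5 * X 1 + X 2 ^ 3 + f₁₂)
    (hg : g = X 3 ^ 2 * (X 2 + X 0 ^ 2) + X 3 * (X 5 + g₉) + X 4 ^ 2
      + X 1 ^ 4 * X 0 + g₁₄) :
    ∃ (h₇ h₉ F₁₂ G₁₄ : MvPolynomial (Fin 6) ℂ)
      (φ : MvPolynomial (Fin 6) ℂ ≃ₐ[ℂ] MvPolynomial (Fin 6) ℂ),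
      h₇ ∈ MvPolynomial.supported ℂ ({0, 1, 2} : Set (Fin 6)) ∧
      h₇.IsWeightedHomogeneous wt 7 ∧
      h₉ ∈ MvPolynomial.supported ℂ ({0, 1, 2, 4} : Set (Fin 6)) ∧
      h₉.IsWeightedHomogeneous wt 9 ∧
      F₁₂ ∈ MvPolynomial.supported ℂ ({0, 1, 2, 4} : Set (Fin 6)) ∧
      F₁₂.IsWeightedHomogeneous wt 12 ∧
      G₁₄ ∈ MvPolynomial.supported ℂ ({0, 1, 2, 4} : Set (Fin 6)) ∧
      G₁₄.IsWeightedHomogeneous wt 14 ∧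
      (∀ (d : ℕ) (p : MvPolynomial (Fin 6) ℂ),
        p.IsWeightedHomogeneous wt d → (φ p).IsWeightedHomogeneous wt d) ∧
      Ideal.map φ.toAlgHom (Ideal.span {f, g}) =
        Ideal.span {X 3 * (X 4 + h₇) + X 1 * (X 5 - h₉) + X 2 ^ 3 + F₁₂,
          X 3 * X 5 + X 4 ^ 2 + X 1 ^ 4 * X 0 + G₁₄} := by
  subst hwt
  have X0 := isWeightedHomogeneous_X ℂ ![2, 3, 4, 5, 7, 9] 0
  have X1 := isWeightedHomogeneous_X ℂ ![2, 3, 4, 5, 7, 9] 1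
  have X2 := isWeightedHomogeneous_X ℂ ![2, 3, 4, 5, 7, 9] 2
  have X3 := isWeightedHomogeneous_X ℂ ![2, 3, 4, 5, 7, 9] 3
  have X4 := isWeightedHomogeneous_X ℂ ![2, 3, 4, 5, 7, 9] 4
  have hdiff : ({0, 1, 2, 4} : Set (Fin 6)) \ {4} = {0, 1, 2} := by
    ext j; fin_cases j <;> simp
  -- Separate the powers of `X 4`; a coefficient of degree `< 7` does not involve `X 4`.
  obtain ⟨a₁₂, b₅, rfl, ha₁₂s, ha₁₂h, hb₅s, hb₅h⟩ :=
    hf₁₂h.exists_eq_add_X_mul (i := 4) (e := 5) hf₁₂s rfl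
  obtain ⟨a₉, b₂, rfl, ha₉s, ha₉h, hb₂s, hb₂h⟩ :=
    hg₉h.exists_eq_add_X_mul (i := 4) (e := 2) hg₉s rfl
  obtain ⟨a₁₄, b₇, rfl, ha₁₄s, ha₁₄h, hb₇s, hb₇h⟩ :=
    hg₁₄h.exists_eq_add_X_mul (i := 4) (e := 7) hg₁₄s rfl
  obtain ⟨c₇, d₀, rfl, hc₇s, hc₇h, hd₀s, hd₀h⟩ :=
    hb₇h.exists_eq_add_X_mul (i := 4) (e := 0) hb₇s rfl
  replace hb₅s := hb₅h.mem_supported_diff hb₅s (i := 4) (by decide)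
  replace hb₂s := hb₂h.mem_supported_diff hb₂s (i := 4) (by decide)
  replace hd₀s := hd₀h.mem_supported_diff hd₀s (i := 4) (by decide)
  clear hf₁₂s hf₁₂h hg₉s hg₉h hg₁₄s hg₁₄h hb₇s hb₇h
  rw [hdiff] at ha₁₂s hb₅s ha₉s hb₂s ha₁₄s hc₇s hd₀s
  have hmono : ∀ {s : Set (Fin 6)} {q : MvPolynomial (Fin 6) ℂ}, q ∈ supported ℂ {0, 1, 2} →
      {0, 1, 2} ⊆ s → q ∈ supported ℂ s := fun hq h => supported_mono h hq
  have hX : ∀ {s : Set (Fin 6)} {j : Fin 6}, j ∈ s → X j ∈ supported ℂ s :=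
    fun h => X_mem_supported.2 h
  have hs₁ : ({0, 1, 2} : Set (Fin 6)) ⊆ {0, 1, 2, 4} := by grind
  have hs₂ : ({0, 1, 2} : Set (Fin 6)) ⊆ {4}ᶜ := by simp [Set.subset_def]
  have hs₃ : ({0, 1, 2, 4} : Set (Fin 6)) ⊆ {5}ᶜ := by simp [Set.subset_def]
  have hs₄ : ({0, 1, 2} : Set (Fin 6)) ⊆ {5}ᶜ := hs₁.trans hs₃
  have D₀ : (1 + d₀).IsWeightedHomogeneous ![2, 3, 4, 5, 7, 9] 0 :=
    (isWeightedHomogeneous_one ℂ _).add hd₀h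
  have D₀s : 1 + d₀ ∈ supported ℂ ({0, 1, 2} : Set (Fin 6)) := add_mem (one_mem _) hd₀s
  obtain ⟨V, hV⟩ : ∃ V, V = X 4 - f₇ := ⟨_, rfl⟩
  have Vh : V.IsWeightedHomogeneous ![2, 3, 4, 5, 7, 9] 7 := hV ▸ X4.sub hf₇h
  have Vs : V ∈ supported ℂ ({0, 1, 2, 4} : Set (Fin 6)) :=
    hV ▸ sub_mem (hX (by simp)) (hmono hf₇s hs₁)
  obtain ⟨B, hB⟩ : ∃ B, B = X 2 + X 0 ^ 2 - X 0 * b₂ + (1 + d₀) * X 0 ^ 2 := ⟨_, rfl⟩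
  have Bh : B.IsWeightedHomogeneous ![2, 3, 4, 5, 7, 9] 4 :=
    hB ▸ ((X2.add (X0.pow 2)).sub (X0.mul hb₂h)).add (D₀.mul (X0.pow 2))
  have Bs : B ∈ supported ℂ ({0, 1, 2} : Set (Fin 6)) :=
    hB ▸ add_mem (sub_mem (add_mem (hX (by simp)) (pow_mem (hX (by simp)) 2))
      (mul_mem (hX (by simp)) hb₂s)) (mul_mem D₀s (pow_mem (hX (by simp)) 2))
  obtain ⟨h₉, hh₉⟩ : ∃ h₉, h₉ = a₉ + V * b₂ - (X 0 * V * (1 + d₀) + X 0 * V * (1 + d₀))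
    - X 0 * c₇ := ⟨_, rfl⟩
  have h₉h : h₉.IsWeightedHomogeneous ![2, 3, 4, 5, 7, 9] 9 :=
    hh₉ ▸ ((ha₉h.add (Vh.mul hb₂h)).sub
      (((X0.mul Vh).mul D₀).add ((X0.mul Vh).mul D₀))).sub (X0.mul hc₇h)
  have h₉s : h₉ ∈ supported ℂ ({0, 1, 2, 4} : Set (Fin 6)) := by
    have h : X 0 * V * (1 + d₀) ∈ supported ℂ ({0, 1, 2, 4} : Set (Fin 6)) :=
      mul_mem (mul_mem (hX (by simp)) Vs) (hmono D₀s hs₁)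
    exact hh₉ ▸ sub_mem (sub_mem (add_mem (hmono ha₉s hs₁) (mul_mem Vs (hmono hb₂s hs₁)))
      (add_mem h h)) (mul_mem (hX (by simp)) (hmono hc₇s hs₁))
  obtain ⟨α, hα₄, hα, hαh⟩ := exists_elementary_algEquiv (w := ![2, 3, 4, 5, 7, 9]) (4 : Fin 6)
    (p := f₇ + X 3 * X 0)
    (add_mem (hmono hf₇s hs₂) (mul_mem (hX (by simp)) (hX (by simp)))) (hf₇h.add (X3.mul X0))
  obtain ⟨β, hβ₅, hβ, hβh⟩ := exists_elementary_algEquiv (w := ![2, 3, 4, 5, 7, 9]) (5 : Fin 6)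
    (p := h₉ + X 3 * B)
    (add_mem (supported_mono hs₃ h₉s) (mul_mem (hX (by simp)) (hmono Bs hs₄)))
    (h₉h.add (X3.mul Bh))
  have hfix : ∀ q ∈ supported ℂ ({0, 1, 2} : Set (Fin 6)), β (α q) = q := fun q hq => by
    rw [hα q (hmono hq hs₂), hβ q (hmono hq hs₄)]
  have h0 : β (α (X 0)) = X 0 := hfix _ (hX (by simp))
  have h1 : β (α (X 1)) = X 1 := hfix _ (hX (by simp))
  have h2 : β (α (X 2)) = X 2 := hfix _ (hX (by simp))
  have h3 : β (α (X 3)) = X 3 := by rw [hα _ (hX (by simp)), hβ _ (hX (by simp))]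
  have h4 : β (α (X 4)) = V - X 3 * X 0 := by
    rw [hα₄, map_sub, map_add, map_mul, hβ _ (hX (by simp)), hβ _ (hmono hf₇s hs₄),
      hβ _ (hX (by simp)), hβ _ (hX (by simp)), hV]
    ring
  have h5 : β (α (X 5)) = X 5 - (h₉ + X 3 * B) := by rw [hα _ (hX (by simp)), hβ₅]
  refine ⟨-(X 0 * b₅) - X 1 * B, h₉, a₁₂ + V * b₅,
    V ^ 2 * (1 + d₀) - X 4 ^ 2 + a₁₄ + V * c₇, α.trans β, ?_, ?_, h₉s, h₉h, ?_, ?_, ?_, ?_,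
    fun d p hp => hβh d _ (hαh d p hp), ?_⟩
  · exact sub_mem (neg_mem (mul_mem (hX (by simp)) hb₅s)) (mul_mem (hX (by simp)) Bs)
  · exact (X0.mul hb₅h).neg.sub (X1.mul Bh)
  · exact add_mem (hmono ha₁₂s hs₁) (mul_mem Vs (hmono hb₅s hs₁))
  · exact ha₁₂h.add (Vh.mul hb₅h)
  · exact add_mem (add_mem (sub_mem (mul_mem (pow_mem Vs 2) (hmono D₀s hs₁))
      (pow_mem (hX (by simp)) 2)) (hmono ha₁₄s hs₁)) (mul_mem Vs (hmono hc₇s hs₁))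
  · exact ((((Vh.pow 2).mul D₀).sub (X4.pow 2)).add ha₁₄h).add (Vh.mul hc₇h)
  · rw [Ideal.map_span, Set.image_pair]
    congr 2
    · simp [hf, h0, h1, h2, h3, h4, h5, hfix _ hf₇s, hfix _ ha₁₂s, hfix _ hb₅s]
      rw [hV]
      ring
    · simp [hg, h0, h1, h2, h3, h4, h5, hfix _ ha₉s, hfix _ hb₂s, hfix _ ha₁₄s, hfix _ hc₇s,
        hfix _ hd₀s]
      rw [hh₉, hB]
      ring
end
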